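/- arXiv:1602.03715 — 2 statements merged into one kernel-verified Lean document; each statement's English description precedes it below -/
import Mathlib

section
/- Let f ∈ ℤ[x] be a polynomial of degree at most 6 and h ∈ ℤ[x] of degree at most 3. Then 2^{12} divides disc_6(4f + h²) in ℤ, i.e., Δ(f,h) := 2^{−12}·disc_6(4f + h²) is an integer. -/
open Polynomial

/-- The Sylvester matrix of two polynomials `f`, `g` with respect to formal degrees
`m`, `n`: an `(n + m) × (n + m)` matrix whose first `n` rows carry the coefficients
of `f` and whose last `m` rows carry the coefficients of `g`. -/
def sylvesterMatrix {R : Type*} [CommRing R] (m n : ℕ) (f g : R[X]) :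
    Matrix (Fin (n + m)) (Fin (n + m)) R := fun i j =>
  if (i : ℕ) < n then
    if (i : ℕ) ≤ (j : ℕ) ∧ (j : ℕ) ≤ (i : ℕ) + m then f.coeff (m + i - j) else 0
  else
    if (i : ℕ) - n ≤ (j : ℕ) ∧ (j : ℕ) ≤ ((i : ℕ) - n) + n then
      g.coeff (n + ((i : ℕ) - n) - j) else 0

/-- The resultant of `f` and `g` with respect to formal degrees `m`, `n`. -/
def res' {R : Type*} [CommRing R] (m n : ℕ) (f g : R[X]) : R :=
  (sylvesterMatrix m n f g).det

/-- The universal degree-6 discriminant form `disc₆`, extended polynomially to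
polynomials of degree at most 6.  It is characterized by the polynomial identity
`a₆ * disc6Poly g = (-1)^15 * Res(g, g')` (Sylvester resultant with formal degrees
`(6,5)`); since the first column of the Sylvester matrix has only the entries `a₆`
(row `0`) and `6 * a₆` (row `5`), Laplace expansion along that column exhibits the
exact quotient by `a₆` as a signed combination of two `10 × 10` minors.  This is a
homogeneous polynomial of degree 10 with integer coefficients in `a₀, …, a₆`. -/
noncomputable def disc6Poly {R : Type*} [CommRing R] (g : R[X]) : R :=
  let M : Matrix (Fin 11) (Fin 11) R := sylvesterMatrix 6 5 g (derivative g);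
  -(((M.submatrix (Fin.succAbove 0) Fin.succ).det)
    - 6 * ((M.submatrix (Fin.succAbove 5) Fin.succ).det))

/-- The discriminant `Δ(f,h) = 2⁻¹² · disc₆(4f + h²)` of an integral Weierstrass
model `y² + h(x)y = f(x)`. -/
noncomputable def DeltaZ (f h : Polynomial ℤ) : ℤ := disc6Poly (4 * f + h ^ 2) / 2 ^ 12


/-- The matrix whose rows list the coefficients (of `x^10, …, x^0`) of given polynomials. -/
noncomputable def rowM {R : Type*} [CommRing R] (P : Fin 11 → R[X]) : Matrix (Fin 11) (Fin 11) R :=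
  Matrix.of fun (i j : Fin 11) => (P i).coeff (10 - (j : ℕ))

section Aux
variable {R : Type*} [CommRing R]

/-- rows of the Sylvester matrix, as polynomials -/
noncomputable def sylRows (g u : R[X]) : Fin 11 → R[X] := fun i =>
  if (i : ℕ) < 5 then X ^ (4 - (i : ℕ)) * g else X ^ (10 - (i : ℕ)) * u

lemma sylvester_eq_rowM (g u : R[X]) (hg : g.natDegree ≤ 6) (hu : u.natDegree ≤ 5) :
    sylvesterMatrix 6 5 g u = rowM (sylRows g u) := by
  ext i j
  have hi := i.isLt
  have hj := j.isLt
  simp only [sylvesterMatrix, rowM, sylRows, Matrix.of_apply]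
  by_cases h5 : (i : ℕ) < 5
  · rw [if_pos h5, if_pos h5, coeff_X_pow_mul']
    by_cases h1 : (i : ℕ) ≤ j
    · by_cases h2 : (j : ℕ) ≤ i + 6
      · rw [if_pos ⟨h1, h2⟩, if_pos (by omega)]
        congr 1; omega
      · rw [if_neg (by omega), if_neg (by omega)]
    · rw [if_neg (by omega), if_pos (by omega), coeff_eq_zero_of_natDegree_lt (by omega)]
  · rw [if_neg h5, if_neg h5, coeff_X_pow_mul']
    by_cases h1 : (i : ℕ) - 5 ≤ j
    · by_cases h2 : (j : ℕ) ≤ i - 5 + 5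
      · rw [if_pos ⟨h1, h2⟩, if_pos (by omega)]
        congr 1; omega
      · rw [if_neg (by omega), if_neg (by omega)]
    · rw [if_neg (by omega), if_pos (by omega), coeff_eq_zero_of_natDegree_lt (by omega)]

lemma rowM_mul (A : Matrix (Fin 11) (Fin 11) R) (Q : Fin 11 → R[X]) :
    A * rowM Q = rowM fun i => ∑ k, C (A i k) * Q k := by
  ext i j
  simp [Matrix.mul_apply, rowM]

lemma coeff_six_mul_disc (g : R[X]) :
    g.coeff 6 * disc6Poly g = - (sylvesterMatrix 6 5 g (derivative g)).det := by
  have h := Matrix.det_succ_column_zero (sylvesterMatrix 6 5 g (derivative g))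
  simp only [disc6Poly]
  rw [h, Finset.sum_eq_add (0 : Fin 11) 5 (by decide)]
  · have e0 : sylvesterMatrix 6 5 g (derivative g) 0 0 = g.coeff 6 := by
      simp [sylvesterMatrix]
    have e5 : sylvesterMatrix 6 5 g (derivative g) (5 : Fin 11) 0 = g.coeff 6 * 6 := by
      have : ((5 : Fin 11) : ℕ) = 5 := rfl
      simp only [sylvesterMatrix, this]
      simp [coeff_derivative]
      norm_num
    erw [e0, e5]
    have : ((5 : Fin 11) : ℕ) = 5 := rfl
    rw [this]
    simp only [Fin.val_zero]
    ring
  · intro c _ hc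
    have : sylvesterMatrix 6 5 g (derivative g) c 0 = 0 := by
      have h0 : (c : ℕ) ≠ 0 := fun h => hc.1 (Fin.ext h)
      have h5 : (c : ℕ) ≠ 5 := fun h => hc.2 (Fin.ext h)
      simp only [sylvesterMatrix, Fin.val_zero]
      split_ifs <;> first | rfl | omega
    erw [this]; simp
  · simp
  · simp

/-- left factor -/
noncomputable def leftN (h : R[X]) : Matrix (Fin 11) (Fin 11) R := Matrix.of fun i k =>
  if (i : ℕ) < 5 then (if i = k then 1 else 0)
  else if (i : ℕ) < 8 then
    (if (k : ℕ) < 5 then (X ^ (7 - (i : ℕ)) * derivative h).coeff (4 - k)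
      else - (X ^ (7 - (i : ℕ)) * h).coeff (10 - k))
  else (if i = k then 1 else 0)

lemma det_leftN (h : R[X]) (hh : h.natDegree ≤ 3) : (leftN h).det = - h.coeff 3 ^ 3 := by
  rw [← Matrix.det_submatrix_equiv_self (Equiv.addRight (5 : Fin 11)),
    Matrix.det_of_isUpperTriangular]
  · simp [Fin.prod_univ_succ, leftN, Fin.val_add]
    simp [coeff_X_pow_mul']
    try ring
  · intro i j hij
    have hv : ∀ a : Fin 11, ((a + 5 : Fin 11) : ℕ) = if (a : ℕ) < 6 then a + 5 else a - 6 := by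
      decide
    simp only [id] at hij
    have hij' : (j : ℕ) < i := hij
    have hne : i + 5 ≠ j + 5 := fun h => by
      have := add_right_cancel h
      omega
    simp only [Matrix.submatrix_apply, Equiv.coe_addRight, leftN, Matrix.of_apply, if_neg hne, hv,
      coeff_X_pow_mul']
    have hi := i.isLt
    split_ifs <;> first
      | rfl
      | omega
      | (rw [coeff_eq_zero_of_natDegree_lt (by omega)]; simp)

/-- right factor -/
noncomputable def rightT (h : R[X]) : Fin 11 → R[X] := fun i =>
  if (i : ℕ) < 8 then X ^ (7 - (i : ℕ)) * h else X ^ (10 - (i : ℕ))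

lemma det_rightT (h : R[X]) (hh : h.natDegree ≤ 3) :
    (rowM (rightT h)).det = h.coeff 3 ^ 8 := by
  rw [Matrix.det_of_isUpperTriangular]
  · simp [Fin.prod_univ_succ, rowM, rightT, coeff_X_pow_mul', coeff_X]
    try ring
  · intro i j hij
    have hij' : (j : ℕ) < i := hij
    have hi := i.isLt
    simp only [rowM, rightT, Matrix.of_apply]
    split_ifs
    · rw [coeff_X_pow_mul']
      split_ifs
      · exact coeff_eq_zero_of_natDegree_lt (by omega)
      · rfl
    · rw [coeff_X_pow, if_neg (by omega)]

/-- Rows that are multiples of `h` modulo 2 give a determinant divisible by 8,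
up to powers of the leading coefficient of `h`. -/
lemma eight_dvd (h : R[X]) (hh : h.natDegree ≤ 3) (a b P : Fin 11 → R[X])
    (ha : ∀ i, (a i).natDegree < 8) (hP : ∀ i, P i = a i * h + 2 * b i) :
    (2 : R) ^ 3 ∣ (h.coeff 3 ^ 8) ^ 10 * (rowM P).det := by
  set T := rowM (rightT h) with hT
  let A : Matrix (Fin 11) (Fin 11) R := Matrix.of fun i k =>
    if (k : ℕ) < 8 then (a i).coeff (7 - k) else 0
  have h1 : rowM P = A * T + (2 : R) • rowM b := by
    rw [hT, rowM_mul]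
    ext i j
    have : P i = (∑ k, C (A i k) * rightT h k) + 2 * b i := by
      rw [hP i]
      congr 1
      conv_lhs => rw [(a i).as_sum_range' 8 (ha i)]
      simp [Fin.sum_univ_succ, Finset.sum_range_succ, A, rightT, ← C_mul_X_pow_eq_monomial]
      ring
    simp only [rowM, Matrix.of_apply, Matrix.add_apply, Matrix.smul_apply]
    rw [this, coeff_add, ← C_ofNat, coeff_C_mul]
    rfl
  let Y := rowM b * T.adjugate
  let W : Matrix (Fin 11) (Fin 11) R := Matrix.of fun (i j : Fin 11) =>
    if (j : ℕ) < 8 then T.det * A i j + 2 * Y i j else Y i j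
  have h2 : rowM P * T.adjugate = Matrix.of fun (i j : Fin 11) => (if (j : ℕ) < 8 then (1 : R) else 2) *
      W i j := by
    rw [h1, add_mul, Matrix.mul_assoc, Matrix.mul_adjugate, Matrix.smul_mul]
    ext i j
    simp only [Matrix.add_apply, Matrix.mul_smul, Matrix.smul_apply, Matrix.mul_one, smul_eq_mul,
      Matrix.of_apply]
    split_ifs with hj
    · simp [Y, W, hj]
    · simp [A, hj, Y, W]
  have h3 := congrArg Matrix.det h2
  rw [Matrix.det_mul, Matrix.det_adjugate, hT, det_rightT h hh] at h3
  rw [Fintype.card_fin, mul_comm] at h3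
  replace h3 := h3.trans (Matrix.det_mul_row (fun j : Fin 11 => if (j : ℕ) < 8 then (1 : R) else 2) W)
  refine ⟨W.det, h3.trans ?_⟩
  congr 1
  simp [Fin.prod_univ_succ]
  try norm_num

lemma main_dvd [IsDomain R] (h2 : Prime (2 : R)) (f h : R[X]) (hf : f.natDegree ≤ 6)
    (hh : h.natDegree ≤ 3) (h3 : ¬ (2 : R) ∣ h.coeff 3) :
    (2 : R) ^ 12 ∣ disc6Poly (4 * f + h ^ 2) := by
  set g := 4 * f + h ^ 2 with hg
  let u := 2 * derivative f + h * derivative h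
  have hdf : (derivative f).natDegree ≤ 5 := (natDegree_derivative_le f).trans (by omega)
  have hdh : (derivative h).natDegree ≤ 2 := (natDegree_derivative_le h).trans (by omega)
  have hgd : g.natDegree ≤ 6 := by
    refine natDegree_add_le_of_degree_le ?_ ?_
    · rw [← C_ofNat]; exact (natDegree_C_mul_le _ _).trans hf
    · exact natDegree_pow_le.trans (by omega)
  have hgu : derivative g = 2 * u := by
    simp only [hg, u, derivative_add, derivative_mul, derivative_pow, derivative_ofNat]
    simp [C_ofNat]
    ring
  have hgd' : (derivative g).natDegree ≤ 5 := (natDegree_derivative_le g).trans (by omega)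
  have hg6 : g.coeff 6 = 4 * f.coeff 6 + h.coeff 3 ^ 2 := by
    rw [hg, coeff_add, ← C_ofNat, coeff_C_mul]
    congr 1
    exact coeff_pow_of_natDegree_le (m := 2) hh
  have hg6' : ¬ (2 : R) ∣ g.coeff 6 := by
    rw [hg6]
    intro hd
    have : (2 : R) ∣ h.coeff 3 ^ 2 := (dvd_add_right ⟨2 * f.coeff 6, by ring⟩).1 hd
    exact h3 (h2.dvd_of_dvd_pow this)
  have s1 : (rowM (sylRows g (derivative g))).det = 2 ^ 6 * (rowM (sylRows g u)).det := by
    have : rowM (sylRows g (derivative g)) = Matrix.of fun (i j : Fin 11) =>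
        (if (i : ℕ) < 5 then (1 : R) else 2) * rowM (sylRows g u) i j := by
      ext i j
      simp only [rowM, sylRows, Matrix.of_apply]
      split_ifs
      · simp
      · rw [hgu, ← coeff_C_mul]; congr 1; simp only [C_ofNat]; ring
    rw [this, Matrix.det_mul_column]
    congr 1
    simp [Fin.prod_univ_succ]
    try norm_num
  let P : Fin 11 → R[X] := fun i =>
    if (i : ℕ) < 5 then X ^ (4 - (i : ℕ)) * g
    else if (i : ℕ) < 8 then X ^ (7 - (i : ℕ)) * (2 * f * derivative h - derivative f * h)
    else X ^ (10 - (i : ℕ)) * u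
  have s2 : leftN h * rowM (sylRows g u) = Matrix.of fun (i j : Fin 11) =>
      (if (i : ℕ) < 5 then (1 : R) else if (i : ℕ) < 8 then 2 else 1) * rowM P i j := by
    rw [rowM_mul]
    ext i j
    simp only [rowM, Matrix.of_apply]
    rw [← coeff_C_mul]
    congr 1
    by_cases h5 : (i : ℕ) < 5
    · simp only [leftN, P, h5, Matrix.of_apply, if_true]
      simp
      simp [sylRows, h5]
    by_cases h8 : (i : ℕ) < 8
    · have key : ∀ s : R[X], s.natDegree ≤ 2 →
          ∑ k : Fin 11, C (if (k : ℕ) < 5 then (s * derivative h).coeff (4 - k)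
            else - (s * h).coeff (10 - k)) * sylRows g u k
          = s * derivative h * g - s * h * u := by
        intro s hs
        have d1 : (s * derivative h).natDegree < 5 := by
          have := natDegree_mul_le (p := s) (q := derivative h); omega
        have d2 : (s * h).natDegree < 6 := by
          have := natDegree_mul_le (p := s) (q := h); omega
        conv_rhs => rw [(s * derivative h).as_sum_range' 5 d1, (s * h).as_sum_range' 6 d2]
        simp [Fin.sum_univ_succ, Finset.sum_range_succ, sylRows, ← C_mul_X_pow_eq_monomial]
        ring
      have k := key (X ^ (7 - (i : ℕ))) ((natDegree_X_pow_le _).trans (by omega))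
      simp only [leftN, Matrix.of_apply, h5, h8, if_false, if_true, P]
      rw [k, hg]
      simp only [u, C_ofNat]
      ring
    · simp only [leftN, P, h5, h8, Matrix.of_apply, if_false]
      simp
      simp [sylRows, h5]
  have s2' := congrArg Matrix.det s2
  rw [Matrix.det_mul, det_leftN h hh, Matrix.det_mul_column] at s2'
  have hprod : (∏ i : Fin 11, (if (i : ℕ) < 5 then (1 : R) else if (i : ℕ) < 8 then 2 else 1))
      = 2 ^ 3 := by
    simp [Fin.prod_univ_succ]
    try norm_num
  rw [hprod] at s2'
  let a : Fin 11 → R[X] := fun i =>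
    if (i : ℕ) < 5 then X ^ (4 - (i : ℕ)) * h
    else if (i : ℕ) < 8 then X ^ (7 - (i : ℕ)) * (- derivative f)
    else X ^ (10 - (i : ℕ)) * derivative h
  let b : Fin 11 → R[X] := fun i =>
    if (i : ℕ) < 5 then X ^ (4 - (i : ℕ)) * (2 * f)
    else if (i : ℕ) < 8 then X ^ (7 - (i : ℕ)) * (f * derivative h)
    else X ^ (10 - (i : ℕ)) * derivative f
  have s3 := eight_dvd h hh a b P (by
      intro i
      have hXn : ∀ n, (X ^ n : R[X]).natDegree ≤ n := natDegree_X_pow_le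
      simp only [a]
      split_ifs
      · have := natDegree_mul_le (p := (X : R[X]) ^ (4 - (i : ℕ))) (q := h)
        have := hXn (4 - (i : ℕ)); omega
      · have := natDegree_mul_le (p := (X : R[X]) ^ (7 - (i : ℕ))) (q := - derivative f)
        rw [natDegree_neg] at this
        have := hXn (7 - (i : ℕ)); omega
      · have := natDegree_mul_le (p := (X : R[X]) ^ (10 - (i : ℕ))) (q := derivative h)
        have := hXn (10 - (i : ℕ)); omega)
    (by
      intro i
      simp only [P, a, b]
      split_ifs
      · rw [hg]; ring
      · ring
      · simp only [u]; ring)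
  have hpw : ∀ n, ¬ (2 : R) ∣ h.coeff 3 ^ n := fun n hd => h3 (h2.dvd_of_dvd_pow hd)
  have s4 : (2 : R) ^ 3 ∣ (rowM P).det :=
    h2.pow_dvd_of_dvd_mul_left 3 (by rw [← pow_mul]; exact hpw _) s3
  have s5 : (2 : R) ^ 6 ∣ (rowM (sylRows g u)).det := by
    refine h2.pow_dvd_of_dvd_mul_left 6 (a := - h.coeff 3 ^ 3) ?_ ?_
    · rw [dvd_neg]; exact hpw 3
    · rw [s2']
      obtain ⟨c, hc⟩ := s4
      exact ⟨c, by rw [hc]; ring⟩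
  refine h2.pow_dvd_of_dvd_mul_left 12 hg6' ?_
  rw [coeff_six_mul_disc, sylvester_eq_rowM _ _ hgd hgd', s1, dvd_neg]
  obtain ⟨c, hc⟩ := s5
  exact ⟨c, by rw [hc]; ring⟩

lemma disc6_map {S : Type*} [CommRing S] (φ : R →+* S) (g : R[X]) :
    disc6Poly (g.map φ) = φ (disc6Poly g) := by
  have hM : sylvesterMatrix 6 5 (g.map φ) (derivative (g.map φ))
      = φ.mapMatrix (sylvesterMatrix 6 5 g (derivative g)) := by
    ext i j
    simp only [sylvesterMatrix, derivative_map, RingHom.mapMatrix_apply, Matrix.map_apply,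
      coeff_map]
    split_ifs <;> simp
  simp only [disc6Poly]
  rw [hM]
  simp only [map_neg, map_sub, map_mul, map_ofNat, RingHom.map_det]
  rfl

end Aux

/-- for integral `f` of degree ≤ 6 and `h` of degree ≤ 3, `2¹²` divides
`disc₆(4f + h²)` in `ℤ`, so `Δ(f,h) = 2⁻¹²·disc₆(4f + h²)` is an integer. -/
theorem two_pow_twelve_dvd_disc (f h : Polynomial ℤ)
    (hf : f.natDegree ≤ 6) (hh : h.natDegree ≤ 3) :
    (2 : ℤ) ^ 12 ∣ disc6Poly (4 * f + h ^ 2) := by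
  let φ : ℤ →+* ℤ[X] := C
  let F : ℤ[X][X] := f.map φ
  let H : ℤ[X][X] := h.map φ + C X * X ^ 3
  have p2 : Prime (2 : ℤ[X]) := by
    have : Prime (C (2 : ℤ)) := prime_C_iff.2 Int.prime_two
    simpa using this
  have hF : F.natDegree ≤ 6 := natDegree_map_le.trans hf
  have hH : H.natDegree ≤ 3 :=
    natDegree_add_le_of_degree_le (natDegree_map_le.trans hh) (natDegree_C_mul_X_pow_le _ _)
  have hH3 : ¬ (2 : ℤ[X]) ∣ H.coeff 3 := by
    have e : H.coeff 3 = C (h.coeff 3) + X := by simp [H, φ]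
    rw [e]
    rintro ⟨c, hc⟩
    have := congrArg (fun p => p.coeff 1) hc
    rw [← C_ofNat] at this
    simp only [coeff_add, coeff_C_mul, coeff_X_one, coeff_C] at this
    simp at this
    omega
  have key := main_dvd p2 F H hF hH hH3
  have k2 := map_dvd (evalRingHom (0 : ℤ)) key
  rw [← disc6_map] at k2
  have hc : (evalRingHom (0 : ℤ)).comp φ = RingHom.id ℤ := Subsingleton.elim _ _
  have e : (4 * F + H ^ 2).map (evalRingHom (0 : ℤ)) = 4 * f + h ^ 2 := by
    simp [F, H, Polynomial.map_map, hc]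
  rw [e] at k2
  simpa using k2
end

section
/- For f, h polynomials over a field F of characteristic ≠ 2 with deg f ≤ 6, deg h ≤ 3, suppose a change of variables x' = (ax+b)/(cx+d), y' = (ey + j(x))/(cx+d)³ with ad−bc, e ∈ F^×, j ∈ F[x], deg j ≤ 3 transforms the Weierstrass model y² + h(x)y = f(x) into (y')² + h'(x')y' = f'(x'). Then Δ(f',h') = e^{20}(ad−bc)^{−30}Δ(f,h), where Δ(f,h) = 2^{−12}disc_6(4f+h²). -/
open Polynomial

/-- `(cX+d)^n · p((aX+b)/(cX+d))` for `p` of degree at most `n`: the substitution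
`x' = (ax+b)/(cx+d)` with denominators cleared. -/
noncomputable def mobiusTransform {F : Type*} [Field F] (n : ℕ) (a b c d : F) (p : F[X]) :
    F[X] :=
  ∑ i ∈ Finset.range (n + 1),
    Polynomial.C (p.coeff i) * (Polynomial.C a * X + Polynomial.C b) ^ i *
      (Polynomial.C c * X + Polynomial.C d) ^ (n - i)

/-- Same substitution as `mobiusTransform`, over a commutative ring. -/
noncomputable def mob {R : Type*} [CommRing R] (n : ℕ) (a b c d : R) (p : R[X]) : R[X] :=
  ∑ i ∈ Finset.range (n + 1),
    Polynomial.C (p.coeff i) * (Polynomial.C a * X + Polynomial.C b) ^ i *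
      (Polynomial.C c * X + Polynomial.C d) ^ (n - i)

theorem mob_map {R S : Type*} [CommRing R] [CommRing S] (φ : R →+* S) (n : ℕ) (a b c d : R)
    (p : R[X]) : (mob n a b c d p).map φ = mob n (φ a) (φ b) (φ c) (φ d) (p.map φ) := by
  simp [mob, Polynomial.map_sum]

theorem sylvesterMatrix_map {R S : Type*} [CommRing R] [CommRing S] (φ : R →+* S) (m n : ℕ)
    (f g : R[X]) : sylvesterMatrix m n (f.map φ) (g.map φ) = (sylvesterMatrix m n f g).map φ := by
  ext i j
  simp only [sylvesterMatrix, Matrix.map_apply, coeff_map]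
  split_ifs <;> simp

theorem disc6Poly_map {R S : Type*} [CommRing R] [CommRing S] (φ : R →+* S) (g : R[X]) :
    disc6Poly (g.map φ) = φ (disc6Poly g) := by
  simp only [disc6Poly, derivative_map, sylvesterMatrix_map, Matrix.submatrix_map, map_neg,
    map_sub, map_mul, RingHom.map_det, map_ofNat, RingHom.mapMatrix_apply]

theorem disc6Poly_C_mul {R : Type*} [CommRing R] (u : R) (g : R[X]) :
    disc6Poly (C u * g) = u ^ 10 * disc6Poly g := by
  have h : sylvesterMatrix 6 5 (C u * g) (derivative (C u * g))
      = u • sylvesterMatrix 6 5 g (derivative g) := by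
    ext i j
    simp only [sylvesterMatrix, Matrix.smul_apply, derivative_C_mul, coeff_C_mul, smul_eq_mul]
    split_ifs <;> simp
  simp only [disc6Poly, h, Matrix.submatrix_smul, Pi.smul_apply, Matrix.det_smul, Fintype.card_fin]
  ring

theorem res'_eq_resultant {R : Type*} [CommRing R] (f g : R[X]) :
    res' 6 5 f g = resultant f g 6 5 := by
  rw [res', resultant, ← Matrix.det_transpose (sylvester f g 6 5),
    ← Matrix.det_submatrix_equiv_self (Fin.revPerm : Equiv.Perm (Fin 11)) (sylvesterMatrix 6 5 f g)]
  congr 1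
  ext i j
  simp only [Matrix.submatrix_apply, Matrix.transpose_apply, sylvester, Matrix.of_apply,
    sylvesterMatrix, Fin.revPerm_apply, Fin.val_rev]
  induction i using Fin.addCases (m := 6) (n := 5) with
  | left i =>
    have := i.2
    have := j.2
    simp only [Fin.addCases_left, Fin.val_castAdd, Set.mem_Icc]
    rw [if_neg (by omega)]
    refine ite_congr (propext (by omega)) (fun h => ?_) (fun _ => rfl)
    congr 1; omega
  | right i =>
    have := i.2
    have := j.2
    simp only [Fin.addCases_right, Fin.val_natAdd, Set.mem_Icc]
    rw [if_pos (by omega)]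
    refine ite_congr (propext (by omega)) (fun h => ?_) (fun _ => rfl)
    congr 1; omega

theorem coeff_mul_disc6Poly {R : Type*} [CommRing R] (g : R[X]) :
    g.coeff 6 * disc6Poly g = - resultant g (derivative g) 6 5 := by
  rw [← res'_eq_resultant, res']
  have key := Matrix.det_succ_column_zero (n := 10) (sylvesterMatrix 6 5 g (derivative g))
  have h0 : ∀ i : Fin 11, i ≠ 0 → i ≠ 5 → sylvesterMatrix 6 5 g (derivative g) i 0 = 0 := by
    intro i hi hi'
    have h1 : (i : ℕ) ≠ 0 := fun h => hi (Fin.ext h)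
    have h2 : (i : ℕ) ≠ 5 := fun h => hi' (Fin.ext h)
    simp only [sylvesterMatrix]
    have h00 : ((0 : Fin (5 + 6)) : ℕ) = 0 := rfl
    rw [h00]
    split_ifs <;> first | rfl | omega
  have e0 : sylvesterMatrix 6 5 g (derivative g) 0 0 = g.coeff 6 := by
    simp [sylvesterMatrix]
  have e5 : sylvesterMatrix 6 5 g (derivative g) (5 : Fin 11) 0 = 6 * g.coeff 6 := by
    have h5 : ((5 : Fin (5 + 6)) : ℕ) = 5 := rfl
    have h00 : ((0 : Fin (5 + 6)) : ℕ) = 0 := rfl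
    simp only [sylvesterMatrix]
    rw [h5, h00]
    simp [coeff_derivative]
    ring
  rw [Fintype.sum_eq_add (0 : Fin 11) 5 (by decide)
    (by rintro i ⟨hi, hi'⟩; rw [h0 i hi hi']; simp)] at key
  rw [e0, e5] at key
  rw [show (sylvesterMatrix 6 5 g (derivative g)).det = _ from key, disc6Poly]
  have h5 : ((5 : Fin 11) : ℕ) = 5 := rfl
  rw [h5]
  simp only [Fin.val_zero]
  ring

theorem disc6Poly_eq_prod {K : Type*} [Field K] [IsAlgClosed K] (g : K[X])
    (hg : g.natDegree = 6) :
    disc6Poly g = - (g.leadingCoeff ^ 4 * (g.roots.map (derivative g).eval).prod) := by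
  have h1 := coeff_mul_disc6Poly g
  have h2 := resultant_eq_prod_eval g (derivative g) 5
    ((natDegree_derivative_le g).trans (by omega)) (IsAlgClosed.splits g)
  have h3 : g.leadingCoeff ≠ 0 := by
    rw [leadingCoeff_ne_zero]; rintro rfl; simp at hg
  rw [hg] at h2
  rw [h2, ← hg, coeff_natDegree] at h1
  apply mul_left_cancel₀ h3
  rw [h1]; ring

theorem mob_aeval {K : Type*} [Field K] (n : ℕ) (a b c d : K) (p : K[X]) (hp : p.natDegree ≤ n)
    (hD : a * d - b * c ≠ 0) :
    algebraMap K[X] (RatFunc K) (mob n a b c d p) =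
      algebraMap K[X] (RatFunc K) (C c * X + C d) ^ n *
      aeval (algebraMap K[X] (RatFunc K) (C a * X + C b) /
        algebraMap K[X] (RatFunc K) (C c * X + C d)) p := by
  have hv : C c * X + C d ≠ 0 := by
    intro h
    have h0 : c = 0 := by simpa using congrArg (fun q => coeff q 1) h
    have h1 : d = 0 := by simpa using congrArg (fun q => coeff q 0) h
    apply hD; simp [h0, h1]
  have hv' : algebraMap K[X] (RatFunc K) (C c * X + C d) ≠ 0 := by
    simpa using (map_ne_zero_iff _ (IsFractionRing.injective K[X] (RatFunc K))).2 hv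
  rw [aeval_eq_sum_range' (Nat.lt_succ_of_le hp), mob, map_sum, Finset.mul_sum]
  refine Finset.sum_congr rfl fun i hi => ?_
  have hi' : i ≤ n := Nat.lt_succ_iff.1 (Finset.mem_range.1 hi)
  rw [map_mul, map_mul, map_pow, map_pow, Algebra.smul_def, div_pow]
  rw [IsScalarTower.algebraMap_apply K K[X] (RatFunc K), Polynomial.algebraMap_eq]
  obtain ⟨k, rfl⟩ := Nat.exists_eq_add_of_le hi'
  rw [Nat.add_sub_cancel_left, pow_add]
  field_simp

theorem mob_mul {K : Type*} [Field K] (m n : ℕ) (a b c d : K) (p q : K[X]) (hp : p.natDegree ≤ m)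
    (hq : q.natDegree ≤ n) (hD : a * d - b * c ≠ 0) :
    mob (m + n) a b c d (p * q) = mob m a b c d p * mob n a b c d q := by
  apply IsFractionRing.injective K[X] (RatFunc K)
  rw [map_mul, mob_aeval _ _ _ _ _ _ hp hD, mob_aeval _ _ _ _ _ _ hq hD,
    mob_aeval _ _ _ _ _ _ (natDegree_mul_le_of_le hp hq) hD, map_mul, pow_add]
  ring

theorem mob_prod {K : Type*} [Field K] (a b c d : K) (R : Multiset K) (hD : a * d - b * c ≠ 0) :
    mob (Multiset.card R) a b c d (R.map (fun r => X - C r)).prod =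
      (R.map (fun r => C (a - r * c) * X + C (b - r * d))).prod := by
  induction R using Multiset.induction_on with
  | empty => simp [mob]
  | cons r R ih =>
    rw [Multiset.card_cons, Multiset.map_cons, Multiset.prod_cons, Multiset.map_cons,
      Multiset.prod_cons, add_comm, mob_mul _ _ _ _ _ _ _ _ (natDegree_X_sub_C_le r)
      (by rw [natDegree_multiset_prod_X_sub_C_eq_card]) hD, ih]
    congr 1
    simp [mob, Finset.sum_range_succ, coeff_X, coeff_C]
    ring

theorem mob_C_mul {R : Type*} [CommRing R] (n : ℕ) (a b c d u : R) (p : R[X]) :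
    mob n a b c d (C u * p) = C u * mob n a b c d p := by
  simp only [mob, coeff_C_mul, Finset.mul_sum, C_mul, mul_assoc]

theorem mob_add {R : Type*} [CommRing R] (n : ℕ) (a b c d : R) (p q : R[X]) :
    mob n a b c d (p + q) = mob n a b c d p + mob n a b c d q := by
  simp only [mob, coeff_add, C_add, ← Finset.sum_add_distrib, add_mul]

theorem eval_derivative_mob {K : Type*} [Field K] (a b c d r s : K) (G : K[X])
    (hG : G.natDegree ≤ 6) (hr : G.eval r = 0) (hs : a * s + b = r * (c * s + d)) :
    (derivative (mob 6 a b c d G)).eval s =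
      (c * s + d) ^ 4 * (a * d - b * c) * (derivative G).eval r := by
  have hD : a * d - b * c = (c * s + d) * (a - c * r) := by linear_combination (-c) * hs
  rw [hD]
  have hG' := as_sum_range' G 7 (by omega)
  have h1 : (derivative G).eval r = G.coeff 1 + 2 * G.coeff 2 * r + 3 * G.coeff 3 * r ^ 2
      + 4 * G.coeff 4 * r ^ 3 + 5 * G.coeff 5 * r ^ 4 + 6 * G.coeff 6 * r ^ 5 := by
    conv_lhs => rw [hG']
    simp [Finset.sum_range_succ, derivative_monomial]
    ring
  have h2 : G.eval r = G.coeff 0 + G.coeff 1 * r + G.coeff 2 * r ^ 2 + G.coeff 3 * r ^ 3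
      + G.coeff 4 * r ^ 4 + G.coeff 5 * r ^ 5 + G.coeff 6 * r ^ 6 := by
    conv_lhs => rw [hG']
    simp [Finset.sum_range_succ]
  rw [hr] at h2
  rw [h1]
  simp [mob, Finset.sum_range_succ, derivative_pow, hs]
  linear_combination (-6 * c * (c * s + d) ^ 5) * h2

theorem disc6Poly_mob_generic {K : Type*} [Field K] [IsAlgClosed K] (a b c d : K) (G : K[X])
    (hG : G.natDegree = 6) (hD : a * d - b * c ≠ 0) (hr : ∀ r, G.eval r = 0 → a - r * c ≠ 0) :
    disc6Poly (mob 6 a b c d G) = (a * d - b * c) ^ 30 * disc6Poly G := by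
  have hG0 : G ≠ 0 := by rintro rfl; simp at hG
  have hA : G.leadingCoeff ≠ 0 := leadingCoeff_ne_zero.2 hG0
  have hsp := IsAlgClosed.splits G
  have hcard : Multiset.card G.roots = 6 := by rw [← hG]; exact hsp.natDegree_eq_card_roots.symm
  have hfac : G = C G.leadingCoeff * (G.roots.map (fun r => X - C r)).prod :=
    hsp.eq_prod_roots
  have hroot : ∀ r ∈ G.roots, a - r * c ≠ 0 := fun r h => hr r ((mem_roots hG0).1 h)
  have hP : (G.roots.map (fun r => a - r * c)).prod ≠ 0 := by
    rw [Ne, Multiset.prod_eq_zero_iff, Multiset.mem_map]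
    rintro ⟨r, h, h'⟩
    exact hroot r h h'
  set s : K → K := fun r => (d * r - b) / (a - r * c) with hs
  have hM : mob 6 a b c d G = C (G.leadingCoeff * (G.roots.map (fun r => a - r * c)).prod) *
      ((G.roots.map s).map (fun r => X - C r)).prod := by
    conv_lhs => rw [hfac, mob_C_mul, ← hcard, mob_prod _ _ _ _ _ hD]
    rw [C_mul, mul_assoc]
    congr 1
    rw [map_multiset_prod, Multiset.map_map, Multiset.map_map, ← Multiset.prod_map_mul]
    congr 1
    refine Multiset.map_congr rfl fun r h => ?_
    have := hroot r h
    simp only [Function.comp]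
    rw [mul_sub, ← C_mul, hs]
    have : (a - r * c) * ((d * r - b) / (a - r * c)) = -(b - r * d) := by field_simp; ring
    rw [this, C_neg, sub_neg_eq_add]
  have hA' : G.leadingCoeff * (G.roots.map (fun r => a - r * c)).prod ≠ 0 := mul_ne_zero hA hP
  have hdeg : (mob 6 a b c d G).natDegree = 6 := by
    rw [hM, natDegree_C_mul hA', natDegree_multiset_prod_X_sub_C_eq_card, Multiset.card_map, hcard]
  have hroots : (mob 6 a b c d G).roots = G.roots.map s := by
    rw [hM, roots_C_mul _ hA', roots_multiset_prod_X_sub_C]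
  have hlead : (mob 6 a b c d G).leadingCoeff =
      G.leadingCoeff * (G.roots.map (fun r => a - r * c)).prod := by
    rw [hM, leadingCoeff_mul, leadingCoeff_C,
      (monic_multiset_prod_of_monic _ _ (fun r _ => monic_X_sub_C r)).leadingCoeff, mul_one]
  have hder : (G.roots.map (fun r => (derivative (mob 6 a b c d G)).eval (s r))).prod =
      (G.roots.map (fun r => c * s r + d)).prod ^ 4 * (a * d - b * c) ^ 6 *
        (G.roots.map (derivative G).eval).prod := by
    rw [Multiset.map_congr rfl (g := fun r => (c * s r + d) ^ 4 * (a * d - b * c) *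
      (derivative G).eval r)]
    · rw [Multiset.prod_map_mul, Multiset.prod_map_mul, Multiset.prod_map_pow,
        Multiset.map_const', Multiset.prod_replicate, hcard]
    · intro r h
      refine eval_derivative_mob a b c d r (s r) G hG.le ((mem_roots hG0).1 h) ?_
      have := hroot r h
      rw [hs]; field_simp; ring
  have hW : (G.roots.map (fun r => c * s r + d)).prod *
      (G.roots.map (fun r => a - r * c)).prod = (a * d - b * c) ^ 6 := by
    rw [← Multiset.prod_map_mul, Multiset.map_congr rfl (g := fun r => a * d - b * c)]
    · rw [Multiset.map_const', Multiset.prod_replicate, hcard]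
    · intro r h
      have h1 := hroot r h
      have h2 : (d * r - b) / (a - r * c) * (a - r * c) = d * r - b := div_mul_cancel₀ _ h1
      rw [hs]
      linear_combination c * h2
  rw [disc6Poly_eq_prod _ hdeg, disc6Poly_eq_prod _ hG, hroots, hlead, Multiset.map_map]
  simp only [Function.comp_def]
  rw [hder]
  set W := (G.roots.map (fun r => c * s r + d)).prod
  set P := (G.roots.map (fun r => a - r * c)).prod
  have : (a * d - b * c) ^ 30 = (W * P) ^ 4 * (a * d - b * c) ^ 6 := by rw [hW]; ring
  rw [this]; ring

theorem disc6Poly_mob {F : Type*} [Field F] (a b c d : F) (G : F[X])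
    (hG : G.natDegree ≤ 6) (hD : a * d - b * c ≠ 0) :
    disc6Poly (mob 6 a b c d G) = (a * d - b * c) ^ 30 * disc6Poly G := by
  let K := AlgebraicClosure (RatFunc F)
  let φ : F[X] →+* K := (algebraMap (RatFunc F) K).comp (algebraMap F[X] (RatFunc F))
  have hφ : Function.Injective φ :=
    (algebraMap (RatFunc F) K).injective.comp (IsFractionRing.injective F[X] (RatFunc F))
  let H : F[X][X] := G.map C + C X * X ^ 6 + C (X ^ 2)
  have hc6 : H.coeff 6 = C (G.coeff 6) + X := by
    simp [H, coeff_C, -map_pow]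
  have hH : H.natDegree = 6 := by
    apply le_antisymm
    · have : (G.map (C : F →+* F[X])).natDegree ≤ 6 := natDegree_map_le.trans hG
      simp only [H]; compute_degree!
    · apply le_natDegree_of_ne_zero
      rw [hc6]; intro h
      simpa using congrArg (fun q => coeff q 1) h
  have hH' : (H.map φ).natDegree = 6 := by rw [natDegree_map_eq_of_injective hφ, hH]
  have hφD : φ (C (a * d - b * c)) = φ (C a) * φ (C d) - φ (C b) * φ (C c) := by
    simp only [map_sub, map_mul]
  have key := disc6Poly_mob_generic (φ (C a)) (φ (C b)) (φ (C c)) (φ (C d)) (H.map φ) hH'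
    (by
      rw [← hφD]
      exact (map_ne_zero_iff _ hφ).2 (C_ne_zero.2 hD))
    (by
      intro r hr h
      have hc : c ≠ 0 := by
        rintro rfl
        have ha : φ (C a) = 0 := by simpa using h
        rw [map_eq_zero_iff _ hφ, C_eq_zero] at ha
        apply hD; simp [ha]
      have hc' : φ (C c) ≠ 0 := (map_ne_zero_iff _ hφ).2 (C_ne_zero.2 hc)
      have hr' : r = φ (C (a / c)) := by
        apply mul_right_cancel₀ hc'
        rw [← map_mul, ← map_mul, div_mul_cancel₀ _ hc]
        exact (sub_eq_zero.1 h).symm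
      rw [hr', eval_map, eval₂_hom, map_eq_zero_iff _ hφ] at hr
      have h3 := congrArg (fun q => coeff q 2) hr
      simp only [H, eval_add, eval_mul, eval_pow, eval_C, eval_X, eval_map, eval₂_hom, ← C_pow,
        coeff_add, coeff_mul_C, coeff_X_pow, coeff_C, coeff_X, coeff_zero] at h3
      simp at h3)
  rw [← mob_map, disc6Poly_map, disc6Poly_map, ← hφD, ← map_pow, ← map_mul] at key
  have key2 := congrArg (evalRingHom (0 : F)) (hφ key)
  rw [map_mul, ← disc6Poly_map, ← disc6Poly_map, mob_map] at key2
  have hev : H.map (evalRingHom (0 : F)) = G := by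
    have : (evalRingHom (0 : F)).comp C = RingHom.id F := by ext; simp
    simp [H, Polynomial.map_map, this]
  rw [hev] at key2
  simpa using key2

/-- if the change of variables `x' = (ax+b)/(cx+d)`,
`y' = (ey + j(x))/(cx+d)³` transforms the Weierstrass model `y² + h(x)y = f(x)` into
`(y')² + h'(x')y' = f'(x')` (expressed by the two polynomial identities obtained by
substituting and comparing coefficients of `y`), then
`Δ(f',h') = e²⁰(ad−bc)⁻³⁰ Δ(f,h)`. -/
theorem Delta_transformation {F : Type*} [Field F] (h2 : (2 : F) ≠ 0)
    (f h f' h' j : F[X]) (a b c d e : F)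
    (hf : f.natDegree ≤ 6) (hh : h.natDegree ≤ 3)
    (hf' : f'.natDegree ≤ 6) (hh' : h'.natDegree ≤ 3) (hj : j.natDegree ≤ 3)
    (hdet : a * d - b * c ≠ 0) (he : e ≠ 0)
    (htrans_h : mobiusTransform 3 a b c d h' = Polynomial.C e * h - 2 * j)
    (htrans_f : j ^ 2 + mobiusTransform 3 a b c d h' * j - mobiusTransform 6 a b c d f' =
      -(Polynomial.C (e ^ 2) * f)) :
    disc6Poly (4 * f' + h' ^ 2) / 2 ^ 12 =
      e ^ 20 * ((a * d - b * c) ^ 30)⁻¹ * (disc6Poly (4 * f + h ^ 2) / 2 ^ 12) := by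
  have hMh : mob 3 a b c d h' = Polynomial.C e * h - 2 * j := htrans_h
  have hMf : j ^ 2 + mob 3 a b c d h' * j - mob 6 a b c d f' = -(Polynomial.C (e ^ 2) * f) :=
    htrans_f
  have h4 : (4 : F[X]) = C (4 : F) := (map_ofNat C 4).symm
  have hdeg : (4 * f' + h' ^ 2).natDegree ≤ 6 := by
    rw [h4]
    refine natDegree_add_le_of_degree_le ((natDegree_C_mul_le _ _).trans hf') ?_
    exact natDegree_pow_le_of_le 2 hh'
  have hM : mob 6 a b c d (4 * f' + h' ^ 2) = C (e ^ 2) * (4 * f + h ^ 2) := by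
    have hsq := mob_mul 3 3 a b c d h' h' hh' hh' hdet
    rw [mob_add, h4, mob_C_mul, sq h', hsq]
    rw [← h4]
    rw [hMh] at hMf ⊢
    rw [C_pow] at hMf ⊢
    linear_combination (-4) * hMf
  have h1 := disc6Poly_mob a b c d (4 * f' + h' ^ 2) hdeg hdet
  rw [hM, disc6Poly_C_mul] at h1
  have h30 : (a * d - b * c) ^ 30 ≠ 0 := pow_ne_zero _ hdet
  have h3 : disc6Poly (4 * f' + h' ^ 2) =
      e ^ 20 * ((a * d - b * c) ^ 30)⁻¹ * disc6Poly (4 * f + h ^ 2) := by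
    apply mul_left_cancel₀ h30
    rw [← h1]
    have := mul_inv_cancel₀ h30
    linear_combination (-(e ^ 20 * disc6Poly (4 * f + h ^ 2))) * this
  rw [h3, mul_div_assoc]
end
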